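/- Let p be a prime and let B be a perfect F_p-algebra that is an integral domain. Then the ideal (p) of W(B) is prime, and the localization W(B)_{(p)} of W(B) at the prime ideal (p) is a discrete valuation ring whose maximal ideal is generated by p. -/

import Mathlib

open WittVector in
/-- The ideal `(p)` of the Witt vectors of a perfect domain is prime. -/
theorem WittVector.isPrime_span_p (p : ℕ) [Fact p.Prime] (B : Type*) [CommRing B] [IsDomain B]
    [CharP B p] [PerfectRing B p] : (Ideal.span {(p : WittVector p B)}).IsPrime := by
  rw [← ker_constantCoeff]
  exact RingHom.ker_isPrime _

/-- For a perfect `𝔽_p`-domain `B`, the ideal `(p)` of `𝕎 B` is prime and the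
localization of `𝕎 B` at `(p)` is a discrete valuation ring whose maximal ideal is generated
by `p`. -/
theorem witt_vectors_localization_at_p_is_dvr
    (p : ℕ) [Fact p.Prime] (B : Type*) [CommRing B] [IsDomain B]
    [CharP B p] [PerfectRing B p] :
    (Ideal.span {(p : WittVector p B)}).IsPrime ∧
    ∀ [hP : (Ideal.span {(p : WittVector p B)}).IsPrime],
      IsDiscreteValuationRing (Localization.AtPrime (Ideal.span {(p : WittVector p B)})) ∧
      IsLocalRing.maximalIdeal
          (Localization.AtPrime (Ideal.span {(p : WittVector p B)})) =
        Ideal.span {(p : Localization.AtPrime (Ideal.span {(p : WittVector p B)}))} := by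
  refine ⟨WittVector.isPrime_span_p p B, fun {hP} => ?_⟩
  set P := Ideal.span {(p : WittVector p B)}
  let f := algebraMap (WittVector p B) (Localization.AtPrime P)
  have hmax : IsLocalRing.maximalIdeal (Localization.AtPrime P) =
      Ideal.span {(p : Localization.AtPrime P)} := by
    rw [← Localization.AtPrime.map_eq_maximalIdeal]
    refine (Ideal.map_span _ _).trans ?_
    rw [Set.image_singleton, map_natCast]
  have hdom : IsDomain (Localization.AtPrime P) :=
    IsLocalization.isDomain_localization P.primeCompl_le_nonZeroDivisors
  have hp0 : (p : Localization.AtPrime P) ≠ 0 := by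
    rw [← map_natCast f]
    exact (map_ne_zero_iff f (IsLocalization.injective _ P.primeCompl_le_nonZeroDivisors)).2
      (WittVector.p_nonzero p B)
  have hprime : Prime (p : Localization.AtPrime P) := by
    rw [← Ideal.span_singleton_prime hp0, ← hmax]
    infer_instance
  refine ⟨IsDiscreteValuationRing.ofHasUnitMulPowIrreducibleFactorization
    ⟨p, hprime.irreducible, fun {x} hx => ?_⟩, hmax⟩
  obtain ⟨a, s, rfl⟩ := IsLocalization.exists_mk'_eq P.primeCompl x
  have ha : a ≠ 0 := by
    rintro rfl
    exact hx (IsLocalization.mk'_zero s)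
  obtain ⟨m, b, hb, rfl⟩ := WittVector.exists_eq_pow_p_mul a ha
  have hbP : b ∈ P.primeCompl := fun h =>
    hb ((WittVector.mem_span_p_iff_coeff_zero_eq_zero b).1 h)
  have hu : IsUnit (IsLocalization.mk' (Localization.AtPrime P) b s) :=
    (IsLocalization.AtPrime.isUnit_mk'_iff (Localization.AtPrime P) P b s).2 hbP
  refine ⟨m, hu.unit, ?_⟩
  rw [IsUnit.unit_spec, ← IsLocalization.mul_mk'_eq_mk'_of_mul, map_pow, map_natCast]
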